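/- arXiv:math-ph/0211046 — 3 statements merged into one kernel-verified Lean document; each statement's English description precedes it below -/
import Mathlib

section
/- Let V be a real vector space of dimension n+k, F a nonzero decomposable n-covector in ΛⁿV*, and suppose F admits two factorizations F = a¹ ∧ ⋯ ∧ a^{n−p} ∧ α and F = b¹ ∧ ⋯ ∧ b^{n−q} ∧ β, where a¹,…,a^{n−p}, b¹,…,b^{n−q} ∈ V* are 2n−p−q linearly independent 1-forms, α ∈ Λ^{p−1}V*, β ∈ Λ^{q−1}V*, and p+q ≥ n+1. Then there exists χ ∈ Λ^{p+q−n−1}V* such that F = a¹ ∧ ⋯ ∧ a^{n−p} ∧ b¹ ∧ ⋯ ∧ b^{n−q} ∧ χ. Moreover, when p+q = n+1 the scalar χ ∈ ℝ is unique. -/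
set_option synthInstance.maxHeartbeats 1000000
set_option maxHeartbeats 1000000
open ExteriorAlgebra

/-- The `d`-th exterior power `Λᵈ W`, as a submodule of the exterior algebra. -/
noncomputable def extPow (d : ℕ) (W : Type*) [AddCommGroup W] [Module ℝ W] :
    Submodule ℝ (ExteriorAlgebra ℝ W) :=
  LinearMap.range (ExteriorAlgebra.ι ℝ : W →ₗ[ℝ] ExteriorAlgebra ℝ W) ^ d

/-- The wedge product `w₁ ∧ ⋯ ∧ w_m` of a tuple of `1`-covectors in the exterior algebra. -/
noncomputable def wedgeProd {W : Type*} [AddCommGroup W] [Module ℝ W] {m : ℕ}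
    (f : Fin m → W) : ExteriorAlgebra ℝ W :=
  (List.ofFn fun i => ExteriorAlgebra.ι ℝ (f i)).prod

/-- Contraction with a linear functional lowers the exterior degree by one. -/
theorem contractLeft_mem_extPow {W : Type*} [AddCommGroup W] [Module ℝ W]
    (v : Module.Dual ℝ W) (d : ℕ) {x : ExteriorAlgebra ℝ W} (hx : x ∈ extPow (d + 1) W) :
    CliffordAlgebra.contractLeft (Q := (0 : QuadraticForm ℝ W)) v x ∈ extPow d W := by
  induction d generalizing x with
  | zero =>
    rw [extPow, zero_add, pow_one] at hx
    obtain ⟨w, rfl⟩ := hx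
    rw [extPow, pow_zero]
    exact (CliffordAlgebra.contractLeft_ι (Q := (0 : QuadraticForm ℝ W)) (d := v) w).symm ▸ Submodule.algebraMap_mem (v w)
  | succ d ih =>
    rw [extPow, pow_succ'] at hx
    induction hx using Submodule.mul_induction_on' with
    | mem_mul_mem m hm y hy =>
      obtain ⟨w, rfl⟩ := hm
      refine (CliffordAlgebra.contractLeft_ι_mul (Q := (0 : QuadraticForm ℝ W))
        (d := v) w y).symm ▸ Submodule.sub_mem _ (Submodule.smul_mem _ _ hy) ?_
      rw [extPow, pow_succ']
      exact Submodule.mul_mem_mul ⟨w, rfl⟩ (ih hy)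
    | add y _ z _ hy hz =>
      rw [map_add]
      exact Submodule.add_mem _ hy hz

/-- A covector annihilated by the members of a tuple that has a dual tuple is divisible by the
wedge product of that tuple. -/
theorem exists_eq_wedgeProd_mul_of_dual {W : Type*} [AddCommGroup W] [Module ℝ W] {m : ℕ}
    (d : ℕ) (c : Fin m → W) (v : Fin m → Module.Dual ℝ W)
    (hv : ∀ i j, v i (c j) = if i = j then 1 else 0) (F : ExteriorAlgebra ℝ W)
    (hF : F ∈ extPow (d + m) W) (hc : ∀ i, ι ℝ (c i) * F = 0) :
    ∃ χ ∈ extPow d W, F = wedgeProd c * χ := by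
  induction m generalizing F with
  | zero => exact ⟨F, hF, by simp [wedgeProd]⟩
  | succ m ih =>
    let G : ExteriorAlgebra ℝ W :=
      CliffordAlgebra.contractLeft (Q := (0 : QuadraticForm ℝ W)) (v 0) F
    have key (j : Fin (m + 1)) : v 0 (c j) • F = ι ℝ (c j) * G := by
      have h := CliffordAlgebra.contractLeft_ι_mul (Q := (0 : QuadraticForm ℝ W))
        (d := v 0) (c j) F
      rw [show CliffordAlgebra.ι (0 : QuadraticForm ℝ W) (c j) * F = 0 from hc j, map_zero] at h
      exact sub_eq_zero.mp h.symm
    obtain ⟨χ, hχ, hG⟩ := ih (fun i => c i.succ) (fun i => v i.succ)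
      (fun i j => by simp [hv]) G (contractLeft_mem_extPow _ _ hF)
      (fun i => by rw [← key, hv, if_neg (Fin.succ_ne_zero i).symm, zero_smul])
    refine ⟨χ, hχ, ?_⟩
    have h0 : F = ι ℝ (c 0) * G := by simpa [hv] using key 0
    rw [h0, hG, ← mul_assoc]
    simp [wedgeProd, List.ofFn_succ]

/-- A linearly independent family in a vector space has a dual family of functionals. -/
theorem LinearIndependent.exists_dual_family {K W κ : Type*} [Field K] [AddCommGroup W]
    [Module K W] [DecidableEq κ] {c : κ → W} (hc : LinearIndependent K c) :
    ∃ v : κ → Module.Dual K W, ∀ i j, v i (c j) = if i = j then 1 else 0 := by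
  obtain ⟨g, hg⟩ := LinearMap.exists_leftInverse_of_injective
    (Finsupp.linearCombination K c) (LinearMap.ker_eq_bot.mpr hc)
  refine ⟨fun i => Finsupp.lapply i ∘ₗ g, fun i j => ?_⟩
  have h := LinearMap.congr_fun hg (Finsupp.single j 1)
  simp only [LinearMap.comp_apply, Finsupp.linearCombination_single, one_smul,
    LinearMap.id_apply] at h
  simp [h, Finsupp.single_apply, eq_comm]

theorem wedgeProd_append {W : Type*} [AddCommGroup W] [Module ℝ W] {m n : ℕ}
    (a : Fin m → W) (b : Fin n → W) :
    wedgeProd (Fin.append a b) = wedgeProd a * wedgeProd b := by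
  simp [wedgeProd, List.ofFn_add]

theorem ι_mul_wedgeProd_self {W : Type*} [AddCommGroup W] [Module ℝ W] {m : ℕ}
    (f : Fin m → W) (i : Fin m) : ι ℝ (f i) * wedgeProd f = 0 :=
  ι_mul_prod_list f i

theorem wedgeProd_mem_extPow {W : Type*} [AddCommGroup W] [Module ℝ W] {m : ℕ}
    (f : Fin m → W) : wedgeProd f ∈ extPow m W := by
  induction m with
  | zero => simp [wedgeProd, extPow, Submodule.one_le.mp le_rfl]
  | succ m ih =>
    rw [wedgeProd, List.ofFn_succ, List.prod_cons, extPow, pow_succ']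
    exact Submodule.mul_mem_mul ⟨_, rfl⟩ (ih _)


/-- let `V` have dimension `n + k` and `F` be a nonzero decomposable covector
(in the exterior algebra of `V*`) admitting the two factorizations
`F = a¹ ∧ ⋯ ∧ a^{n-p} ∧ α` and `F = b¹ ∧ ⋯ ∧ b^{n-q} ∧ β` with the `2n-p-q` one-forms
`a¹,…,a^{n-p},b¹,…,b^{n-q}` linearly independent, `α ∈ Λ^{p-1}V*`, `β ∈ Λ^{q-1}V*` and
`p + q ≥ n + 1`.  Then `F = a¹ ∧ ⋯ ∧ a^{n-p} ∧ b¹ ∧ ⋯ ∧ b^{n-q} ∧ χ` for some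
`χ ∈ Λ^{p+q-n-1}V*`, and when `p + q = n + 1` the scalar `χ ∈ ℝ` is unique. -/
theorem stmt7 {V : Type*} [AddCommGroup V] [Module ℝ V] [FiniteDimensional ℝ V]
    (n k p q : ℕ) (hdim : Module.finrank ℝ V = n + k)
    (hp1 : 1 ≤ p) (hq1 : 1 ≤ q) (hpn : p ≤ n) (hqn : q ≤ n) (hpq : n + 1 ≤ p + q)
    (F : ExteriorAlgebra ℝ (Module.Dual ℝ V)) (hF0 : F ≠ 0)
    (hFdec : ∃ f : Fin (n - 1) → Module.Dual ℝ V, F = wedgeProd f)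
    (a : Fin (n - p) → Module.Dual ℝ V) (b : Fin (n - q) → Module.Dual ℝ V)
    (hab : LinearIndependent ℝ (Sum.elim a b))
    (α β : ExteriorAlgebra ℝ (Module.Dual ℝ V))
    (hα : α ∈ extPow (p - 1) (Module.Dual ℝ V))
    (hβ : β ∈ extPow (q - 1) (Module.Dual ℝ V))
    (hFa : F = wedgeProd a * α) (hFb : F = wedgeProd b * β) :
    (∃ χ ∈ extPow (p + q - n - 1) (Module.Dual ℝ V),
      F = wedgeProd a * wedgeProd b * χ)
    ∧ (p + q = n + 1 →
        ∃! c : ℝ,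
          F = wedgeProd a * wedgeProd b * algebraMap ℝ (ExteriorAlgebra ℝ (Module.Dual ℝ V)) c) := by
  have hmem : F ∈ extPow ((p + q - n - 1) + ((n - p) + (n - q))) (Module.Dual ℝ V) := by
    rw [show (p + q - n - 1) + ((n - p) + (n - q)) = (n - p) + (p - 1) by omega, extPow, pow_add,
      hFa]
    exact Submodule.mul_mem_mul (wedgeProd_mem_extPow a) hα
  have hli : LinearIndependent ℝ (Fin.append a b) := by
    rw [← linearIndependent_equiv finSumFinEquiv]
    convert hab using 1
    exact Fin.append_comp_sumElim
  have hann (i : Fin ((n - p) + (n - q))) : ι ℝ (Fin.append a b i) * F = 0 := by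
    refine Fin.addCases (fun j => ?_) (fun j => ?_) i
    · rw [Fin.append_left, hFa, ← mul_assoc, ι_mul_wedgeProd_self, zero_mul]
    · rw [Fin.append_right, hFb, ← mul_assoc, ι_mul_wedgeProd_self, zero_mul]
  obtain ⟨v, hv⟩ := hli.exists_dual_family
  obtain ⟨χ, hχ, hF⟩ := exists_eq_wedgeProd_mul_of_dual _ _ v hv F hmem hann
  rw [wedgeProd_append] at hF
  refine ⟨⟨χ, hχ, hF⟩, fun hpq' => ?_⟩
  rw [extPow, show p + q - n - 1 = 0 by omega, pow_zero] at hχ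
  obtain ⟨c, rfl⟩ := Submodule.mem_one.mp hχ
  refine ⟨c, hF, fun c' hc' => ?_⟩
  have hne : wedgeProd a * wedgeProd b ≠ 0 := fun h => hF0 (by rw [hF, h, zero_mul])
  rw [hF, ← Algebra.commutes, ← Algebra.commutes, ← Algebra.smul_def, ← Algebra.smul_def] at hc'
  exact (smul_left_injective ℝ hne hc').symm
end

section
/- In M = N × ΛⁿT*N (N = ℝ^{n+k}) with Ω = dθ as above, for a vector field ξ on N let ξ̄ be the canonical lift as in the classification of infinitesimal symplectomorphisms and define P_ξ := ξ ⌟ θ (contraction of the Poincaré–Cartan form). Then ξ̄ ⌟ Ω = −dP_ξ; similarly, if χ = Σ χ_{β₁⋯βₙ}(q) ∂/∂p_{β₁⋯βₙ} with d(χ ⌟ Ω) = 0 and Q^ζ = Σ ζ_{β₁⋯β_{n−1}}(q) dq^{β₁} ∧ ⋯ ∧ dq^{β_{n−1}} is an (n−1)-form with dQ^ζ = −χ ⌟ Ω, then both P_ξ and Q^ζ are algebraic observable (n−1)-forms. -/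
open scoped BigOperators

namespace Stmt9

/-- Continuous alternating `k`-forms on `E`, as a submodule of continuous multilinear
maps. -/
noncomputable def altSub (k : ℕ) (E : Type*) [NormedAddCommGroup E] [NormedSpace ℝ E] :
    Submodule ℝ (ContinuousMultilinearMap ℝ (fun _ : Fin k => E) ℝ) where
  carrier := {f | ∀ (v : Fin k → E) (i j : Fin k), i ≠ j → v i = v j → f v = 0}
  add_mem' := by
    intro f g hf hg v i j hij hv
    simp [hf v i j hij hv, hg v i j hij hv]
  zero_mem' := by intro v i j hij hv; simp
  smul_mem' := by
    intro c f hf v i j hij hv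
    simp [hf v i j hij hv]

variable {E : Type*} [NormedAddCommGroup E] [NormedSpace ℝ E]

/-- The multisymplectic phase space `M = N × ΛⁿT*N` (the paper's `n` is `n+1` here). -/
abbrev Phase (n : ℕ) (E : Type*) [NormedAddCommGroup E] [NormedSpace ℝ E] : Type _ :=
  E × altSub (n + 1) E

/-- The multisymplectic form `Ω = dθ` on `ΛⁿT*N`, a constant-coefficient form. -/
noncomputable def OmegaLD (n : ℕ) (w : Fin (n + 2) → Phase n E) : ℝ :=
  ∑ i : Fin (n + 2),
    (-1 : ℝ) ^ (i : ℕ) *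
      ((w i).2 : ContinuousMultilinearMap ℝ (fun _ : Fin (n + 1) => E) ℝ)
        (fun j => (w (i.succAbove j)).1)

/-- The exterior derivative of an unbundled `k`-form. -/
noncomputable def extDeriv {F : Type*} [NormedAddCommGroup F] [NormedSpace ℝ F] {k : ℕ}
    (ω : F → (Fin k → F) → ℝ) (x : F) (v : Fin (k + 1) → F) : ℝ :=
  ∑ i : Fin (k + 1), (-1 : ℝ) ^ (i : ℕ) * fderiv ℝ (fun y => ω y (v ∘ i.succAbove)) x (v i)

/-- The infinitesimal action `∑ⱼ p(v₁,…,Lvⱼ,…)` of a linear map on alternating forms. -/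
noncomputable def liftActionAlt (n : ℕ) (L : E →L[ℝ] E) (p : altSub (n + 1) E) :
    altSub (n + 1) E :=
  fderiv ℝ
    (fun t : ℝ =>
      (⟨(p : ContinuousMultilinearMap ℝ (fun _ : Fin (n + 1) => E) ℝ).compContinuousLinearMap
          (fun _ => ContinuousLinearMap.id ℝ E + t • L),
        fun v i j hij hv => by
          have := p.2 (fun l => (ContinuousLinearMap.id ℝ E + t • L) (v l)) i j hij
            (by simp [hv])
          simpa using this⟩ : altSub (n + 1) E)) 0 1

/-- The canonical lift `ξ̄` of a vector field `ξ` on the base to `ΛⁿT*N`: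
`ξ̄ = ∑ ξ^α ∂/∂q^α - ∑ (∂ξ^α/∂q^β) Π^β_α`. -/
noncomputable def xibar (n : ℕ) (ξ : E → E) (m : Phase n E) : Phase n E :=
  (ξ m.1, -liftActionAlt n (fderiv ℝ ξ m.1) m.2)

/-- `P_ξ := ξ ⌟ θ`, the contraction of the Poincaré–Cartan form with (the lift of) `ξ`. -/
noncomputable def Pform (n : ℕ) (ξ : E → E) (m : Phase n E) (v : Fin n → Phase n E) : ℝ :=
  ((m.2 : ContinuousMultilinearMap ℝ (fun _ : Fin (n + 1) => E) ℝ))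
    (Fin.cons (ξ m.1) fun i => (v i).1)

/-- `Q^ζ`, the `(n-1)`-form with base coefficients `ζ`. -/
noncomputable def Qform (n : ℕ) (ζ : E → altSub n E) (m : Phase n E)
    (v : Fin n → Phase n E) : ℝ :=
  ((ζ m.1 : ContinuousMultilinearMap ℝ (fun _ : Fin n => E) ℝ)) fun i => (v i).1

/-- The algebraic alternating map underlying an element of `altSub`. -/
def altSubToAlternatingMap {k : ℕ} (p : altSub k E) : E [⋀^Fin k]→ₗ[ℝ] ℝ :=
  { (p : ContinuousMultilinearMap ℝ (fun _ : Fin k => E) ℝ).toMultilinearMap with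
    map_eq_zero_of_eq' := fun v i j hv hij => p.2 v i j hij hv }

theorem altSub_update_eq {k : ℕ} (p : altSub (k + 1) E) (v : Fin (k + 1) → E)
    (i : Fin (k + 1)) (x : E) :
    (p : ContinuousMultilinearMap ℝ (fun _ : Fin (k + 1) => E) ℝ) (Function.update v i x) =
      (-1 : ℝ) ^ (i : ℕ) *
        (p : ContinuousMultilinearMap ℝ (fun _ : Fin (k + 1) => E) ℝ)
          (Fin.cons x fun j => v (i.succAbove j)) := by
  have h := (altSubToAlternatingMap p).map_insertNth i x (i.removeNth v)
  rw [Fin.insertNth_removeNth] at h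
  simp only [zsmul_eq_mul, Int.cast_pow, Int.cast_neg, Int.cast_one] at h
  exact h

/-- A curve in a subspace is differentiable if it is so in the ambient space and the derivative
lies in the subspace. -/
theorem hasDerivAt_of_hasDerivAt_coe {F : Type*} [NormedAddCommGroup F] [NormedSpace ℝ F]
    {S : Submodule ℝ F} {f : ℝ → S} {f' : S} {t : ℝ}
    (h : HasDerivAt (fun s => (f s : F)) (f' : F) t) : HasDerivAt f f' t := by
  rw [hasDerivAt_iff_isLittleO] at h ⊢
  exact Asymptotics.isLittleO_norm_left.1 (Asymptotics.isLittleO_norm_left.2 h :)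

theorem liftActionAlt_apply (n : ℕ) (L : E →L[ℝ] E) (p : altSub (n + 1) E)
    (v : Fin (n + 1) → E) :
    (liftActionAlt n L p : ContinuousMultilinearMap ℝ (fun _ : Fin (n + 1) => E) ℝ) v =
      ∑ i, (p : ContinuousMultilinearMap ℝ (fun _ : Fin (n + 1) => E) ℝ)
        (Function.update v i (L (v i))) := by
  set P : ContinuousMultilinearMap ℝ (fun _ : Fin (n + 1) => E) ℝ := p.1 with hP
  have hd : DifferentiableAt ℝ (fun t : ℝ => P.compContinuousLinearMap
      (fun _ : Fin (n + 1) => ContinuousLinearMap.id ℝ E + t • L)) 0 := by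
    refine DifferentiableAt.continuousMultilinearMapCompContinuousLinearMap
      (f := fun _ => P) (g := fun _ t => ContinuousLinearMap.id ℝ E + t • L)
      (differentiableAt_const _) fun _ => ?_
    fun_prop
  obtain ⟨D, hD⟩ : ∃ D, HasDerivAt (fun t : ℝ => P.compContinuousLinearMap
      (fun _ : Fin (n + 1) => ContinuousLinearMap.id ℝ E + t • L)) D 0 := ⟨_, hd.hasDerivAt⟩
  have hDw (w : Fin (n + 1) → E) :
      HasDerivAt (fun t : ℝ => P fun j => w j + t • L (w j)) (D w) 0 := by
    have := (ContinuousMultilinearMap.apply ℝ (fun _ : Fin (n + 1) => E) ℝ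
      w).hasFDerivAt.comp_hasDerivAt (0 : ℝ) hD
    exact this
  have hmem : D ∈ altSub (n + 1) E := by
    intro w i j hij hw
    have h0 : (fun t : ℝ => P fun j => w j + t • L (w j)) = fun _ => 0 :=
      funext fun t => p.2 _ i j hij (by simp [hw])
    have h1 := hDw w
    rw [h0] at h1
    exact h1.unique (hasDerivAt_const _ _)
  have hlift : liftActionAlt n L p = ⟨D, hmem⟩ := by
    unfold liftActionAlt
    exact (hasDerivAt_of_hasDerivAt_coe (f' := ⟨D, hmem⟩) hD).deriv
  rw [hlift]
  have hcurve : HasDerivAt (fun (t : ℝ) (j : Fin (n + 1)) => v j + t • L (v j))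
      (fun j => L (v j)) 0 :=
    hasDerivAt_pi.2 fun j => by
      simpa using ((hasDerivAt_id (0 : ℝ)).smul_const (L (v j))).const_add (v j)
  have h2 := (P.hasFDerivAt (x := fun j => v j + (0 : ℝ) • L (v j))).comp_hasDerivAt (0 : ℝ)
    hcurve
  have h3 := (hDw v).unique h2
  simpa [ContinuousMultilinearMap.linearDeriv_apply] using h3

theorem fderiv_apply_cons {V : Type*} [NormedAddCommGroup V] [NormedSpace ℝ V] (n : ℕ)
    (c : V →L[ℝ] ContinuousMultilinearMap ℝ (fun _ : Fin (n + 1) => E) ℝ) {ξ : E → E} {m : E × V}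
    (hξ : DifferentiableAt ℝ ξ m.1) (u : Fin n → E) (w : E × V) :
    fderiv ℝ (fun y : E × V => c y.2 (Fin.cons (ξ y.1) u)) m w =
      c w.2 (Fin.cons (ξ m.1) u) + c m.2 (Fin.cons (fderiv ℝ ξ m.1 w.1) u) := by
  have hg : ∀ i : Fin (n + 1), HasFDerivAt (fun y : E × V => (Fin.cons (ξ y.1) u : _ → E) i)
      ((Fin.cons (fderiv ℝ ξ m.1 ∘L ContinuousLinearMap.fst ℝ E V)
        fun _ => 0 : Fin (n + 1) → E × V →L[ℝ] E) i) m := by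
    refine Fin.cases ?_ fun i => ?_
    · exact hξ.hasFDerivAt.comp m hasFDerivAt_fst
    · exact hasFDerivAt_const _ _
  have h := ((c.hasFDerivAt.comp m hasFDerivAt_snd).continuousMultilinearMap_apply hg).fderiv
  refine (DFunLike.congr_fun h w).trans ?_
  simp [Fin.sum_univ_succ]

theorem extDeriv_Pform (n : ℕ) {ξ : E → E} (hξ : Differentiable ℝ ξ) (m : Phase n E)
    (v : Fin (n + 1) → Phase n E) :
    extDeriv (Pform n ξ) m v = ∑ i : Fin (n + 1), (-1 : ℝ) ^ (i : ℕ) *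
      (((v i).2 : ContinuousMultilinearMap ℝ (fun _ : Fin (n + 1) => E) ℝ)
          (Fin.cons (ξ m.1) fun j => (v (i.succAbove j)).1) +
        (m.2 : ContinuousMultilinearMap ℝ (fun _ : Fin (n + 1) => E) ℝ)
          (Fin.cons (fderiv ℝ ξ m.1 (v i).1) fun j => (v (i.succAbove j)).1)) :=
  Finset.sum_congr rfl fun i _ => congrArg _ <|
    fderiv_apply_cons n (altSub (n + 1) E).subtypeₗᵢ.toContinuousLinearMap (hξ m.1)
      (fun j => (v (i.succAbove j)).1) (v i)

theorem OmegaLD_cons (n : ℕ) (w : Phase n E) (v : Fin (n + 1) → Phase n E) :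
    OmegaLD n (Fin.cons w v) =
      (w.2 : ContinuousMultilinearMap ℝ (fun _ : Fin (n + 1) => E) ℝ) (fun j => (v j).1) -
        ∑ i : Fin (n + 1), (-1 : ℝ) ^ (i : ℕ) *
          ((v i).2 : ContinuousMultilinearMap ℝ (fun _ : Fin (n + 1) => E) ℝ)
            (Fin.cons w.1 fun j => (v (i.succAbove j)).1) := by
  have h (i : Fin (n + 1)) : (fun j => ((Fin.cons w v : Fin (n + 2) → Phase n E)
      (i.succ.succAbove j)).1) = (Fin.cons w.1 fun j => (v (i.succAbove j)).1) := by
    funext j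
    refine Fin.cases ?_ (fun j => ?_) j <;> simp
  unfold OmegaLD
  rw [Fin.sum_univ_succ]
  simp [h, pow_succ, sub_eq_add_neg]

theorem OmegaLD_xibar (n : ℕ) {ξ : E → E} (hξ : Differentiable ℝ ξ) (m : Phase n E)
    (v : Fin (n + 1) → Phase n E) :
    OmegaLD n (Fin.cons (xibar n ξ m) v) = -extDeriv (Pform n ξ) m v := by
  rw [OmegaLD_cons, extDeriv_Pform n hξ]
  simp only [xibar, Submodule.coe_neg, neg_apply,
    liftActionAlt_apply, altSub_update_eq, mul_add, Finset.sum_add_distrib]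
  ring

/-- on `M = ΛⁿT*N` with `Ω = dθ`, for any smooth vector field `ξ` on the
base, `ξ̄ ⌟ Ω = -dP_ξ` where `P_ξ = ξ ⌟ θ`; and if `χ` is a vertical field with
`dQ^ζ = -χ ⌟ Ω`, then both `P_ξ` and `Q^ζ` are algebraic observable `(n-1)`-forms. -/
theorem stmt9 (n : ℕ) {E : Type*} [NormedAddCommGroup E] [NormedSpace ℝ E]
    (ξ : E → E) (hξ : ContDiff ℝ (⊤ : ℕ∞) ξ)
    (ζ : E → altSub n E)
    (hζ : ∀ v : Fin n → E, ContDiff ℝ (⊤ : ℕ∞) fun q =>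
      (ζ q : ContinuousMultilinearMap ℝ (fun _ : Fin n => E) ℝ) v)
    (χ : E → altSub (n + 1) E)
    (hχ : ∀ v : Fin (n + 1) → E, ContDiff ℝ (⊤ : ℕ∞) fun q =>
      (χ q : ContinuousMultilinearMap ℝ (fun _ : Fin (n + 1) => E) ℝ) v)
    (hQ : ∀ (m : Phase n E) (v : Fin (n + 1) → Phase n E),
      extDeriv (Qform n ζ) m v + OmegaLD n (Fin.cons ((0 : E), χ m.1) v) = 0) :
    (∀ (m : Phase n E) (v : Fin (n + 1) → Phase n E),
      OmegaLD n (Fin.cons (xibar n ξ m) v) = -extDeriv (Pform n ξ) m v)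
    ∧ (∃ XP : Phase n E → Phase n E, ∀ (m : Phase n E) (v : Fin (n + 1) → Phase n E),
        extDeriv (Pform n ξ) m v + OmegaLD n (Fin.cons (XP m) v) = 0)
    ∧ (∃ XQ : Phase n E → Phase n E, ∀ (m : Phase n E) (v : Fin (n + 1) → Phase n E),
        extDeriv (Qform n ζ) m v + OmegaLD n (Fin.cons (XQ m) v) = 0) := by
  have hP := OmegaLD_xibar n (hξ.differentiable (by simp))
  refine ⟨hP, ⟨xibar n ξ, fun m v => ?_⟩, ⟨fun m => (0, χ m.1), hQ⟩⟩
  rw [hP m v, add_neg_cancel]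

end Stmt9
end

section
/- Let (M, Ω) be a multisymplectic manifold equipped with a copolarisation P*T*M, let H be a smooth admissible Hamiltonian, and let 1 ≤ p, q ≤ n with p+q ≥ n. For F an observable (p−1)-form and G an observable (q−1)-form, define traces {H,F} := (−1)^{(n−p)p}[X]^H ⌞ dF ∈ P^{n−p}TM. Then for any Hamiltonian n-curve Γ and any (p+q−n)-vector Y tangent to Γ at a point m, one has ⟨{H,F} ∧ Y, dG⟩ = (−1)^{(n−p)(n−q)} ⟨{H,G} ∧ Y, dF⟩. -/
/-- The sign of the inversions between two finsets: `-1` to the number of pairs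
`(i, j) ∈ S × T` with `j < i`. -/
def inversionSign {ι : Type*} [LinearOrder ι] (S T : Finset ι) : ℝ :=
  ∏ i ∈ S, ∏ j ∈ T, if j < i then -1 else 1

/-- The value of an alternating form on the vectors of a family indexed by `t`, listed in
increasing order; zero if `t` does not have the right cardinality. -/
noncomputable def sortedEval {ι V : Type*} [LinearOrder ι] [AddCommGroup V] [Module ℝ V] {k : ℕ}
    (g : V [⋀^Fin k]→ₗ[ℝ] ℝ) (X : ι → V) (t : Finset ι) : ℝ :=
  if h : t.card = k then g (fun i => X (t.orderEmbOfFin h i)) else 0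

theorem neg_one_pow_mul_self (k : ℕ) : (-1 : ℝ) ^ k * (-1) ^ k = 1 := by
  rw [← mul_pow]
  simp

section inversionSign

variable {ι : Type*} [LinearOrder ι]

theorem inversionSign_union_left {S T : Finset ι} (U : Finset ι) (h : Disjoint S T) :
    inversionSign (S ∪ T) U = inversionSign S U * inversionSign T U :=
  Finset.prod_union h

theorem inversionSign_mul_self (S T : Finset ι) : inversionSign S T * inversionSign S T = 1 := by
  simp_rw [inversionSign, ← Finset.prod_mul_distrib]
  refine Finset.prod_eq_one fun i _ => Finset.prod_eq_one fun j _ => ?_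
  split_ifs <;> norm_num

theorem inversionSign_mul_swap {S T : Finset ι} (h : Disjoint S T) :
    inversionSign S T * inversionSign T S = (-1) ^ (S.card * T.card) := by
  have h1 : inversionSign T S = ∏ i ∈ S, ∏ j ∈ T, if i < j then (-1 : ℝ) else 1 :=
    Finset.prod_comm
  have h2 : ∀ i ∈ S, ∀ j ∈ T,
      (if j < i then (-1 : ℝ) else 1) * (if i < j then (-1 : ℝ) else 1) = -1 := by
    intro i hi j hj
    rcases lt_or_gt_of_ne (Finset.disjoint_iff_ne.1 h i hi j hj) with hij | hij <;>
      simp [hij, hij.not_gt]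
  rw [h1, inversionSign, ← Finset.prod_mul_distrib]
  simp_rw [← Finset.prod_mul_distrib]
  rw [Finset.prod_congr rfl fun i hi => Finset.prod_congr rfl (h2 i hi)]
  simp [pow_mul']

theorem prod_orderEmbOfFin (s : Finset ι) {k : ℕ} (h : s.card = k) (φ : ι → ℝ) :
    ∏ i, φ (s.orderEmbOfFin h i) = ∏ x ∈ s, φ x := by
  conv_rhs => rw [← s.map_orderEmbOfFin_univ h, Finset.prod_map]
  rfl

theorem prod_fin_ite_lt (k : ℕ) :
    ∏ i : Fin k, ∏ j : Fin k, (if j < i then (-1 : ℝ) else 1) = (-1) ^ (k * (k - 1) / 2) := by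
  have h (i : Fin k) : ∏ j : Fin k, (if j < i then (-1 : ℝ) else 1) = (-1) ^ (i : ℕ) := by
    rw [Finset.prod_ite]
    simp [Finset.filter_gt_eq_Iio]
  simp_rw [h]
  rw [Finset.prod_pow_eq_pow_sum, Fin.sum_univ_eq_sum_range (fun i => i), Finset.sum_range_id]

theorem inversionSign_self (s : Finset ι) :
    inversionSign s s = (-1) ^ (s.card * (s.card - 1) / 2) := by
  rw [← prod_fin_ite_lt, inversionSign, ← prod_orderEmbOfFin s rfl]
  refine Finset.prod_congr rfl fun i _ => ?_
  rw [← prod_orderEmbOfFin s rfl]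
  simp

end inversionSign

theorem inversionSign_univ_right {n : ℕ} (s : Finset (Fin n)) :
    inversionSign s Finset.univ = (-1) ^ (∑ i ∈ s, (i : ℕ)) := by
  rw [← Finset.prod_pow_eq_pow_sum]
  refine Finset.prod_congr rfl fun i _ => ?_
  rw [Finset.prod_ite]
  simp [Finset.filter_gt_eq_Iio]

/-- The sign of the shuffle `(s, sᶜ)` of `Fin n`. -/
theorem inversionSign_compl {n : ℕ} (s : Finset (Fin n)) :
    inversionSign s sᶜ = (-1) ^ ((∑ i ∈ s, (i : ℕ)) + s.card * (s.card - 1) / 2) := by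
  have h : inversionSign s Finset.univ = inversionSign s s * inversionSign s sᶜ := by
    rw [inversionSign, inversionSign, inversionSign, ← Finset.prod_mul_distrib]
    exact Finset.prod_congr rfl fun i _ => (Finset.prod_mul_prod_compl s _).symm
  rw [pow_add, ← inversionSign_univ_right, h, inversionSign_self, mul_right_comm,
    neg_one_pow_mul_self, one_mul]

section sort

variable {ι V : Type*} [LinearOrder ι] [AddCommGroup V] [Module ℝ V]

theorem map_comp_eq_prod_mul_sortedEval {k : ℕ} (g : V [⋀^Fin k]→ₗ[ℝ] ℝ) (X : ι → V)
    {a : Fin k → ι} (ha : Function.Injective a) :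
    g (fun i => X (a i)) = (∏ i, ∏ j, if i < j ∧ a j < a i then (-1 : ℝ) else 1) *
      sortedEval g X (Finset.univ.image a) := by
  have hcard : (Finset.univ.image a).card = k := by simp [Finset.card_image_of_injective _ ha]
  set t := Finset.univ.image a with ht
  have hmem (i : Fin k) : a i ∈ t := by simp [ht]
  let b : Fin k → Fin k := fun i => (t.orderIsoOfFin hcard).symm ⟨a i, hmem i⟩
  have hb (i : Fin k) : t.orderEmbOfFin hcard (b i) = a i := by
    rw [← Finset.coe_orderIsoOfFin_apply]; simp [b]
  have hbinj : Function.Injective b := fun i j hij => ha (by rw [← hb i, ← hb j, hij])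
  let σ : Equiv.Perm (Fin k) := Equiv.ofBijective b (Finite.injective_iff_bijective.1 hbinj)
  have hσ (i : Fin k) : σ i = b i := rfl
  have hcomp : (fun i => X (a i)) = (fun i => X (t.orderEmbOfFin hcard i)) ∘ σ := by
    funext i; simp [hσ, hb]
  have hsign : ((σ.sign : ℤ) : ℝ) = ∏ i, ∏ j, if i < j ∧ a j < a i then (-1 : ℝ) else 1 := by
    rw [Equiv.Perm.sign_eq_prod_prod_Ioi]
    push_cast
    refine Finset.prod_congr rfl fun i _ => ?_
    rw [← Finset.filter_lt_eq_Ioi, Finset.prod_filter]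
    refine Finset.prod_congr rfl fun j _ => ?_
    by_cases hij : i < j
    · have hlt : σ i < σ j ↔ a i < a j := by
        rw [← hb i, ← hb j, OrderEmbedding.lt_iff_lt, hσ, hσ]
      rcases lt_or_gt_of_ne (ha.ne hij.ne) with h | h <;> simp [hij, hlt, h, h.not_gt]
    · simp [hij]
  rw [hcomp, g.map_perm, sortedEval, dif_pos hcard, ← hsign, Units.smul_def, zsmul_eq_mul]

theorem map_append_eq {k a b : ℕ} (h : k = a + b) (g : V [⋀^Fin k]→ₗ[ℝ] ℝ) (X : ι → V)
    {u : Fin a → ι} {v : Fin b → ι} (hu : StrictMono u) (hv : StrictMono v) :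
    g (fun j => Fin.append (fun i => X (u i)) (fun i => X (v i)) (Fin.cast h j)) =
      if Disjoint (Finset.univ.image u) (Finset.univ.image v) then
        inversionSign (Finset.univ.image u) (Finset.univ.image v) *
          sortedEval g X (Finset.univ.image u ∪ Finset.univ.image v)
      else 0 := by
  subst h
  have happ : (fun j : Fin (a + b) =>
      Fin.append (fun i => X (u i)) (fun i => X (v i)) (Fin.cast rfl j)) =
      fun j => X (Fin.append u v j) := by
    funext j
    refine Fin.addCases (fun i => ?_) (fun i => ?_) j <;> simp
  rw [happ]
  split_ifs with hd
  · have hne (i : Fin a) (j : Fin b) : u i ≠ v j :=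
      Finset.disjoint_iff_ne.1 hd _ (by simp) _ (by simp)
    have hinj : Function.Injective (Fin.append u v) :=
      Fin.append_injective_iff.2 ⟨hu.injective, hv.injective, hne⟩
    have himg : Finset.univ.image (Fin.append u v) =
        Finset.univ.image u ∪ Finset.univ.image v := by
      ext x
      simp only [Finset.mem_image, Finset.mem_univ, true_and, Finset.mem_union]
      constructor
      · rintro ⟨j, rfl⟩
        refine Fin.addCases (fun i => ?_) (fun i => ?_) j <;> simp
      · rintro (⟨i, rfl⟩ | ⟨i, rfl⟩)
        · exact ⟨Fin.castAdd b i, by simp⟩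
        · exact ⟨Fin.natAdd a i, by simp⟩
    rw [map_comp_eq_prod_mul_sortedEval g X hinj, himg]
    congr 1
    rw [inversionSign, Finset.prod_image (fun _ _ _ _ h => hu.injective h), Fin.prod_univ_add]
    have h1 (i : Fin b) : ∏ j, (if Fin.natAdd a i < j ∧ Fin.append u v j <
        Fin.append u v (Fin.natAdd a i) then (-1 : ℝ) else 1) = 1 := by
      refine Finset.prod_eq_one fun j _ => if_neg ?_
      refine Fin.addCases (fun j => ?_) (fun j => ?_) j
      · rintro ⟨h, -⟩
        simp only [Fin.lt_def, Fin.val_natAdd, Fin.val_castAdd] at h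
        omega
      · rintro ⟨h, h'⟩
        simp only [Fin.append_right, hv.lt_iff_lt] at h'
        simp only [Fin.lt_def, Fin.val_natAdd] at h h'
        omega
    rw [Finset.prod_congr rfl fun i _ => h1 i, Finset.prod_const_one, mul_one]
    refine Finset.prod_congr rfl fun i _ => ?_
    rw [Finset.prod_image (fun _ _ _ _ h => hv.injective h), Fin.prod_univ_add]
    have h2 (j : Fin a) : (if Fin.castAdd b i < Fin.castAdd b j ∧ Fin.append u v (Fin.castAdd b j) <
        Fin.append u v (Fin.castAdd b i) then (-1 : ℝ) else 1) = 1 := by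
      refine if_neg ?_
      rintro ⟨h, h'⟩
      simp only [Fin.append_left, hu.lt_iff_lt] at h'
      exact lt_asymm h h'
    rw [Finset.prod_congr rfl fun j _ => h2 j, Finset.prod_const_one, one_mul]
    refine Finset.prod_congr rfl fun j _ => ?_
    have h3 : Fin.castAdd b i < Fin.natAdd a j := by
      simp only [Fin.lt_def, Fin.val_natAdd, Fin.val_castAdd]
      omega
    simp [h3]
  · refine g.map_eq_zero_of_not_injective _ fun hinj => hd ?_
    rw [Finset.disjoint_left]
    simp only [Finset.mem_image, Finset.mem_univ, true_and]
    rintro _ ⟨i, rfl⟩ ⟨j, hj⟩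
    have := @hinj (Fin.castAdd b i) (Fin.natAdd a j) (by simp [hj])
    simp [Fin.ext_iff] at this
    omega

end sort

/-- The shuffle sum `⟨(X ⌞ f) ∧ Y, g⟩`, with `Y` the subfamily of `X` selected by `ν`, as a sum
over the index sets containing those of `Y`. -/
theorem shuffle_sum_eq {V : Type*} [AddCommGroup V] [Module ℝ V] {n p q m : ℕ}
    (f : V [⋀^Fin p]→ₗ[ℝ] ℝ) (g : V [⋀^Fin q]→ₗ[ℝ] ℝ) (X : Fin n → V)
    {ν : Fin m → Fin n} (hν : StrictMono ν) (hq : q = n - p + m) :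
    ∑ s : {s : Finset (Fin n) // s.card = p},
        (-1 : ℝ) ^ ((∑ i ∈ s.1, (i : ℕ)) + p * (p - 1) / 2) *
          f (fun i => X (s.1.orderEmbOfFin s.2 i)) *
          g (fun j =>
            Fin.append (fun i : Fin (n - p) => X ((s.1ᶜ).orderEmbOfFin (by
                  simp [Finset.card_compl, s.2]) i))
              (fun i => X (ν i))
              (Fin.cast hq j)) =
      ∑ s with Finset.univ.image ν ⊆ s, inversionSign s sᶜ * sortedEval f X s *
        (inversionSign sᶜ (Finset.univ.image ν) *
          sortedEval g X (sᶜ ∪ Finset.univ.image ν)) := by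
  set N := Finset.univ.image ν with hN
  let φ : Finset (Fin n) → ℝ := fun s => if N ⊆ s then inversionSign s sᶜ * sortedEval f X s *
    (inversionSign sᶜ N * sortedEval g X (sᶜ ∪ N)) else 0
  have hφ (s : {s : Finset (Fin n) // s.card = p}) :
      (-1 : ℝ) ^ ((∑ i ∈ s.1, (i : ℕ)) + p * (p - 1) / 2) *
          f (fun i => X (s.1.orderEmbOfFin s.2 i)) *
          g (fun j =>
            Fin.append (fun i : Fin (n - p) => X ((s.1ᶜ).orderEmbOfFin (by
                  simp [Finset.card_compl, s.2]) i))
              (fun i => X (ν i))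
              (Fin.cast hq j)) = φ s.1 := by
    obtain ⟨s, rfl⟩ := s
    rw [map_append_eq hq g X (OrderEmbedding.strictMono _) hν, ← inversionSign_compl,
      Finset.image_orderEmbOfFin_univ, ← hN]
    have hdis : Disjoint sᶜ N ↔ N ⊆ s := by
      rw [disjoint_comm, disjoint_compl_right_iff]
    simp only [φ, sortedEval, hdis, mul_ite, mul_zero, dite_true]
  rw [Finset.sum_congr rfl fun s _ => hφ s, Finset.sum_filter,
    ← Finset.sum_subtype (Finset.univ.filter fun s : Finset (Fin n) => s.card = p) (by simp) φ,
    Finset.sum_filter]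
  refine Finset.sum_congr rfl fun s _ => ?_
  split_ifs with hs hN hN <;> simp [φ, sortedEval, hs, hN]

/-- the generalized dynamical bracket identity
`⟨{H,F} ∧ Y, dG⟩ = (-1)^{(n-p)(n-q)} ⟨{H,G} ∧ Y, dF⟩` for observable forms of degrees
`p-1` and `q-1` with `p + q ≥ n`, along a Hamiltonian `n`-curve.  Pointwise model: `X` is a
decomposable Hamiltonian `n`-vector (tuple) spanning the tangent space of the curve, `Y`
is the sub-multivector `X ∘ ν` of `X` tangent to the slice, `f = dF_m`, `g = dG_m`, and the
traces `{H,F} = (-1)^{(n-p)p} X ⌞ dF` are expanded via shuffle sums over `p`-element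
subsets of `Fin n` with their shuffle signs. -/
theorem stmt14 {V : Type*} [AddCommGroup V] [Module ℝ V] [FiniteDimensional ℝ V]
    (n p q : ℕ) (hp1 : 1 ≤ p) (hq1 : 1 ≤ q) (hpn : p ≤ n) (hqn : q ≤ n) (hpq : n ≤ p + q)
    (Ω : V [⋀^Fin (n + 1)]→ₗ[ℝ] ℝ) (dH : V →ₗ[ℝ] ℝ)
    (f : V [⋀^Fin p]→ₗ[ℝ] ℝ) (g : V [⋀^Fin q]→ₗ[ℝ] ℝ)
    (X : Fin n → V)
    (hHam : ∀ w : V, Ω (Fin.snoc X w) = (-1 : ℝ) ^ n * dH w)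
    (ν : Fin (p + q - n) → Fin n) (hν : StrictMono ν) :
    (-1 : ℝ) ^ ((n - p) * p) *
      ∑ s : {s : Finset (Fin n) // s.card = p},
        (-1 : ℝ) ^ ((∑ i ∈ s.1, (i : ℕ)) + p * (p - 1) / 2) *
          f (fun i => X (s.1.orderEmbOfFin s.2 i)) *
          g (fun j =>
            Fin.append (fun i : Fin (n - p) => X ((s.1ᶜ).orderEmbOfFin (by
                  simp [Finset.card_compl, s.2]) i))
              (fun i => X (ν i))
              (Fin.cast (by omega) j))
    = (-1 : ℝ) ^ ((n - p) * (n - q)) * ((-1 : ℝ) ^ ((n - q) * q) *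
        ∑ t : {t : Finset (Fin n) // t.card = q},
          (-1 : ℝ) ^ ((∑ i ∈ t.1, (i : ℕ)) + q * (q - 1) / 2) *
            g (fun i => X (t.1.orderEmbOfFin t.2 i)) *
            f (fun j =>
              Fin.append (fun i : Fin (n - q) => X ((t.1ᶜ).orderEmbOfFin (by
                    simp [Finset.card_compl, t.2]) i))
                (fun i => X (ν i))
                (Fin.cast (by omega) j))) := by
  set N := Finset.univ.image ν with hN
  have hNcard : N.card = p + q - n := by
    simp [hN, Finset.card_image_of_injective _ hν.injective]
  rw [shuffle_sum_eq f g X hν (by omega), shuffle_sum_eq g f X hν (by omega), ← hN]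
  simp_rw [Finset.mul_sum]
  refine Finset.sum_nbij' (fun s => sᶜ ∪ N) (fun t => tᶜ ∪ N) (by simp) (by simp) ?_ ?_ ?_
  · intro s hs
    have hs : N ⊆ s := by simpa using hs
    ext x
    have := @hs x
    simp
    tauto
  · intro s hs
    have hs : N ⊆ s := by simpa using hs
    ext x
    have := @hs x
    simp
    tauto
  intro s hs
  have hs : N ⊆ s := by simpa using hs
  have hinv : (sᶜ ∪ N)ᶜ ∪ N = s := by
    ext x
    have := @hs x
    simp
    tauto
  rw [hinv]
  by_cases hcard : s.card = p
  swap
  · simp [sortedEval, hcard]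
  set C := sᶜ with hC
  set D := (C ∪ N)ᶜ with hD
  have hCN : Disjoint C N := Finset.disjoint_left.2 fun x hx hxN => by
    simp [hC] at hx
    exact hx (hs hxN)
  have hDCN : Disjoint D (C ∪ N) := disjoint_compl_left
  have hDC : Disjoint D C := hDCN.mono_right Finset.subset_union_left
  have hDN : Disjoint D N := hDCN.mono_right Finset.subset_union_right
  obtain ⟨a, ha⟩ := Nat.exists_eq_add_of_le hpn
  obtain ⟨b, hb⟩ := Nat.exists_eq_add_of_le hqn
  obtain ⟨c, hc⟩ := Nat.exists_eq_add_of_le hpq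
  have hNc : N.card = c := by omega
  have hCc : C.card = a := by
    rw [hC, Finset.card_compl, Fintype.card_fin]
    omega
  have hDc : D.card = b := by
    rw [hD, Finset.card_compl, Fintype.card_fin, Finset.card_union_of_disjoint hCN]
    omega
  have e1 := inversionSign_mul_swap hCN
  have e2 := inversionSign_mul_swap hDN
  have e3 := inversionSign_mul_swap hDC
  have e4 : inversionSign s C = inversionSign D C * inversionSign N C := by
    rw [← hinv, inversionSign_union_left _ hDN]
  rw [e4, inversionSign_union_left _ hCN]
  rw [hNc, hCc] at e1
  rw [hNc, hDc] at e2
  rw [hDc, hCc] at e3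
  have hp : p = b + c := by omega
  have hq : q = a + c := by omega
  have hna : n - p = a := by omega
  have hnb : n - q = b := by omega
  have e5 := inversionSign_mul_self C D
  have e6 : inversionSign D C = (-1) ^ (a * b) * inversionSign C D := by
    rw [mul_comm a b, ← e3, mul_assoc, e5, mul_one]
  have ea := neg_one_pow_mul_self (a * c)
  have eb := neg_one_pow_mul_self (b * c)
  have hap : (-1 : ℝ) ^ (a * p) = (-1) ^ (a * b) * (-1) ^ (a * c) := by
    rw [hp, mul_add, pow_add]
  have hbq : (-1 : ℝ) ^ (b * q) = (-1) ^ (a * b) * (-1) ^ (b * c) := by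
    rw [hq, mul_add, pow_add, mul_comm b a]
  rw [hna, hnb, e6, hap, hbq]
  linear_combination (-1 : ℝ) ^ (a * b) * (-1) ^ (a * b) * inversionSign C D *
    sortedEval f X s * sortedEval g X (C ∪ N) *
    ((-1) ^ (a * c) * e1 - (-1) ^ (b * c) * e2 + ea - eb)
end
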